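/- For every real number β and every complex number z with Re z > −β, one has ζ_{β,0}(z) = 2(q^{−1}−q)^z · Σ_{n=0}^∞ (n+1) · q^{β(n+1/2)} · q^{(n+1)z} · (1−q^{2(n+1)})^{−z}, the series on the right converging absolutely. -/

import Mathlib

open Complex Real Filter Finset Topology

/-- The q-number `[x]_q = (q^x - q^{-x})/(q - q⁻¹)`. -/
noncomputable def qnum (q x : ℝ) : ℝ := (q ^ x - q ^ (-x)) / (q - q⁻¹)

/-- For a positive real `a` and `w : ℂ`, `a^w := exp(w · ln a)`. -/
noncomputable def rcpow (a : ℝ) (w : ℂ) : ℂ := Complex.exp (w * (Real.log a : ℂ))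

/-- The `(n,j)`-term of the q-zeta double series, corresponding to
`l = n + 1/2` and `k = j - n - 1/2`: `q^{βl+δk} · [l+1/2]_q^{-z}`. -/
noncomputable def qzetaTerm (q β δ : ℝ) (z : ℂ) (n j : ℕ) : ℂ :=
  ((q ^ (β * ((n : ℝ) + 1/2) + δ * ((j : ℝ) - (n : ℝ) - 1/2)) : ℝ) : ℂ) *
    rcpow (qnum q ((n : ℝ) + 1)) (-z)

/-- The q-zeta function `ζ_{β,δ}(z)` as a double series. -/
noncomputable def qzeta (q β δ : ℝ) (z : ℂ) : ℂ :=
  ∑' n : ℕ, ∑ j ∈ Finset.range (2 * n + 2), qzetaTerm q β δ z n j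

theorem norm_rcpow (a : ℝ) (w : ℂ) : ‖rcpow a w‖ = Real.exp (w.re * Real.log a) := by
  simp [rcpow, Complex.norm_exp]

/-- `log [n+1]_q`, with the q-number factored as `q^{-(n+1)} (1 - q^{2(n+1)}) / (q⁻¹ - q)`. -/
theorem log_qnum_add_one {q : ℝ} (hq0 : 0 < q) (hq1 : q < 1) (n : ℕ) :
    Real.log (qnum q ((n : ℝ) + 1)) =
      -(((n : ℝ) + 1) * Real.log q) + Real.log (1 - q ^ (2 * (n + 1))) - Real.log (q⁻¹ - q) := by
  have hinv : 0 < q⁻¹ - q := by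
    have := (one_lt_inv₀ hq0).2 hq1
    linarith
  have hpow : 0 < 1 - q ^ (2 * (n + 1)) := by
    have := pow_lt_one₀ hq0.le hq1 (n := 2 * (n + 1)) (by omega)
    linarith
  have hq : 0 < q ^ (n + 1) := by positivity
  have hfactor : qnum q ((n : ℝ) + 1) =
      (q ^ (n + 1))⁻¹ * (1 - q ^ (2 * (n + 1))) / (q⁻¹ - q) := by
    have hcast : q ^ ((n : ℝ) + 1) = q ^ (n + 1) := by
      rw [← Real.rpow_natCast]
      push_cast
      rfl
    have hneg : q - q⁻¹ = -(q⁻¹ - q) := by ring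
    rw [qnum, Real.rpow_neg hq0.le, hcast, hneg, div_neg, ← neg_div]
    congr 1
    rw [mul_comm 2, pow_mul]
    field_simp
    ring
  rw [hfactor, Real.log_div (by positivity) hinv.ne', Real.log_mul (by positivity) hpow.ne',
    Real.log_inv, Real.log_pow]
  push_cast
  ring

theorem rcpow_qnum_add_one {q : ℝ} (hq0 : 0 < q) (hq1 : q < 1) (z : ℂ) (n : ℕ) :
    rcpow (qnum q ((n : ℝ) + 1)) (-z) =
      rcpow (q⁻¹ - q) z * rcpow q (((n : ℂ) + 1) * z) * rcpow (1 - q ^ (2 * (n + 1))) (-z) := by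
  simp only [rcpow, log_qnum_add_one hq0 hq1, ← Complex.exp_add]
  push_cast
  ring_nf

theorem sum_qzetaTerm_zero (q β : ℝ) (z : ℂ) (n : ℕ) :
    ∑ j ∈ Finset.range (2 * n + 2), qzetaTerm q β 0 z n j =
      2 * ((((n : ℝ) + 1) * q ^ (β * ((n : ℝ) + 1/2)) : ℝ) : ℂ) *
        rcpow (qnum q ((n : ℝ) + 1)) (-z) := by
  simp only [qzetaTerm, zero_mul, add_zero, Finset.sum_const, Finset.card_range, nsmul_eq_mul]
  push_cast
  ring

theorem rpow_mul_norm_rcpow_mul_norm_rcpow_le {q : ℝ} (hq0 : 0 < q) (hq1 : q < 1) (β : ℝ)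
    (z : ℂ) (n : ℕ) :
    q ^ (β * ((n : ℝ) + 1/2)) * ‖rcpow q (((n : ℂ) + 1) * z)‖ *
        ‖rcpow (1 - q ^ (2 * (n + 1))) (-z)‖ ≤
      q ^ (β / 2 + z.re) * Real.exp (|z.re| * -Real.log (1 - q ^ 2)) * (q ^ (β + z.re)) ^ n := by
  have hsq : 0 < 1 - q ^ 2 := by nlinarith
  have hle : 1 - q ^ 2 ≤ 1 - q ^ (2 * (n + 1)) := by
    have := pow_le_pow_of_le_one hq0.le hq1.le (show 2 ≤ 2 * (n + 1) by omega)
    linarith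
  have hlog : Real.log (1 - q ^ 2) ≤ Real.log (1 - q ^ (2 * (n + 1))) :=
    Real.log_le_log hsq hle
  have hlog0 : Real.log (1 - q ^ (2 * (n + 1))) ≤ 0 :=
    Real.log_nonpos (hsq.le.trans hle) (by linarith [pow_pos hq0 (2 * (n + 1))])
  have hre : (((n : ℂ) + 1) * z).re = ((n : ℝ) + 1) * z.re := by simp
  have hfac : -z.re * Real.log (1 - q ^ (2 * (n + 1))) ≤ |z.re| * -Real.log (1 - q ^ 2) := by
    nlinarith [le_abs_self z.re, abs_nonneg z.re]
  rw [norm_rcpow, norm_rcpow, hre, Complex.neg_re, Real.rpow_def_of_pos hq0,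
    Real.rpow_def_of_pos hq0, Real.rpow_def_of_pos hq0, ← Real.exp_nat_mul, ← Real.exp_add,
    ← Real.exp_add, ← Real.exp_add, ← Real.exp_add, Real.exp_le_exp]
  linarith

theorem summable_add_one_mul_geometric {r : ℝ} (hr0 : 0 ≤ r) (hr1 : r < 1) :
    Summable fun n : ℕ => ((n : ℝ) + 1) * r ^ n := by
  have hr : ‖r‖ < 1 := by rwa [Real.norm_of_nonneg hr0]
  simpa [add_mul] using (summable_pow_mul_geometric_of_norm_lt_one 1 hr).add
    (summable_geometric_of_lt_one hr0 hr1)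

theorem statement7 (q : ℝ) (hq0 : 0 < q) (hq1 : q < 1) (β : ℝ)
    (z : ℂ) (hz : -β < z.re) :
    Summable (fun n : ℕ =>
      ‖(((n : ℝ) + 1) * q ^ (β * ((n : ℝ) + 1/2)) : ℝ) *
        rcpow q ((((n : ℕ) + 1 : ℂ)) * z) * rcpow (1 - q ^ (2 * (n + 1))) (-z)‖) ∧
    qzeta q β 0 z =
      2 * rcpow (q⁻¹ - q) z *
        ∑' n : ℕ, (((n : ℝ) + 1) * q ^ (β * ((n : ℝ) + 1/2)) : ℝ) *
          rcpow q ((((n : ℕ) + 1 : ℂ)) * z) * rcpow (1 - q ^ (2 * (n + 1))) (-z) := by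
  constructor
  · have hr1 : q ^ (β + z.re) < 1 := Real.rpow_lt_one hq0.le hq1 (by linarith)
    refine Summable.of_nonneg_of_le (fun _ => norm_nonneg _) (fun n => ?_)
      ((summable_add_one_mul_geometric (by positivity) hr1).mul_left
        (q ^ (β / 2 + z.re) * Real.exp (|z.re| * -Real.log (1 - q ^ 2))))
    rw [norm_mul, norm_mul, Complex.norm_real, Real.norm_of_nonneg (by positivity)]
    have h := mul_le_mul_of_nonneg_left
      (rpow_mul_norm_rcpow_mul_norm_rcpow_le hq0 hq1 β z n) (show (0 : ℝ) ≤ n + 1 by positivity)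
    linarith
  · rw [qzeta, ← tsum_mul_left]
    refine tsum_congr fun n => ?_
    rw [sum_qzetaTerm_zero, rcpow_qnum_add_one hq0 hq1]
    ring
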